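/- There is no rank-3 matroid on a 6-element set with exactly 11 bases. -/

import Mathlib

variable {α : Type*} [Fintype α] [DecidableEq α]

/-- The matroid rank axioms (R1), (R2), (R3) for an integer-valued rank
function on the subsets of a finite ground set (the whole type `α`). -/
def RankAxioms (r : Finset α → ℤ) : Prop :=
  (∀ A : Finset α, 0 ≤ r A ∧ r A ≤ (A.card : ℤ)) ∧
  (∀ A B : Finset α, A ⊆ B → r A ≤ r B) ∧
  (∀ A B : Finset α, r (A ∩ B) + r (A ∪ B) ≤ r A + r B)

/-- A flat: adding any element outside `F` strictly increases the rank. -/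
def IsFlat (r : Finset α → ℤ) (F : Finset α) : Prop :=
  ∀ x : α, x ∉ F → r F < r (insert x F)

/-- A hyperplane: a flat of rank one less than the rank of the matroid. -/
def IsHyperplane (r : Finset α → ℤ) (H : Finset α) : Prop :=
  IsFlat r H ∧ r H = r Finset.univ - 1

/-- A circuit: a minimal dependent set. -/
def IsCircuit (r : Finset α → ℤ) (C : Finset α) : Prop :=
  r C < (C.card : ℤ) ∧ ∀ D : Finset α, D ⊂ C → r D = (D.card : ℤ)

/-- A flat of the single-element deletion `M \\ e`: a subset of the ground
set minus `e` such that adding any other element of the ground set minus `e`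
strictly increases the (restricted) rank. -/
def IsFlatDel (r : Finset α → ℤ) (e : α) (F : Finset α) : Prop :=
  F ⊆ Finset.univ.erase e ∧
    ∀ x ∈ Finset.univ.erase e, x ∉ F → r F < r (insert x F)

/-- The rank function of the dual matroid. -/
def dualRank (r : Finset α → ℤ) : Finset α → ℤ :=
  fun A => (A.card : ℤ) + r Aᶜ - r Finset.univ

/-- The class `F₃` of flats of the deletion `M \\ e`: flats `F` of `M \\ e`
such that `F` is not a flat of `M` but `F ∪ {e}` is a flat of `M`. -/
def InF3 (r : Finset α → ℤ) (e : α) (F : Finset α) : Prop :=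
  IsFlatDel r e F ∧ ¬ IsFlat r F ∧ IsFlat r (insert e F)

namespace ElevenBases

/-- The twenty triples of `Fin 6`, in lexicographic order. -/
def triples : List (Finset (Fin 6)) :=
  [{0, 1, 2}, {0, 1, 3}, {0, 1, 4}, {0, 1, 5}, {0, 2, 3}, {0, 2, 4}, {0, 2, 5}, {0, 3, 4},
   {0, 3, 5}, {0, 4, 5}, {1, 2, 3}, {1, 2, 4}, {1, 2, 5}, {1, 3, 4}, {1, 3, 5}, {1, 4, 5},
   {2, 3, 4}, {2, 3, 5}, {2, 4, 5}, {3, 4, 5}]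

/-- The `k`-th triple. -/
def T (k : ℕ) : Finset (Fin 6) := triples.getD k ∅

/-- Exchange clauses `(a, b, w)`: if triples `a` and `b` are bases then so is one of the triples
`k` with bit `20 + k` set in `w`; the low bits of `w` are `a` and `b`.
The clauses are grouped by the largest index that occurs. -/
def levels : List (List (ℕ × ℕ × ℕ)) :=
  [[],
   [],
   [],
   [],
   [(2, 4, 3145748), (3, 4, 3145752)],
   [(1, 5, 5242914), (3, 5, 5242920), (4, 2, 34603028), (5, 1, 17825826)],
   [(1, 6, 9437250), (2, 6, 9437252), (4, 3, 68157464), (5, 3, 68157480), (6, 1, 17825858), (6, 2,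
    34603076)],
   [(0, 7, 6291585), (0, 7, 50331777), (1, 5, 150994978), (2, 4, 167772180), (3, 7, 6291592), (4,
    2, 136314900), (5, 1, 138412066), (6, 7, 50331840), (7, 0, 18874497), (7, 0, 37748865)],
   [(0, 8, 10486017), (0, 8, 83886337), (1, 6, 285212738), (2, 8, 10486020), (3, 4, 335544344),
    (4, 3, 270532632), (5, 8, 83886368), (6, 1, 276824130), (7, 3, 270532744), (7, 6, 285212864),
    (8, 0, 18874625), (8, 0, 75497729), (8, 2, 136315140), (8, 5, 150995232)],
   [(0, 9, 12583425), (0, 9, 100663809), (1, 9, 12583426), (1, 9, 402653698), (2, 6, 570425412),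
    (2, 8, 671088900), (3, 5, 603979816), (3, 7, 805306504), (4, 9, 100663824), (4, 9, 402653712),
    (5, 3, 541065256), (5, 8, 671088928), (6, 2, 545259588), (6, 7, 805306560), (7, 3, 541065352),
    (7, 6, 570425536), (8, 2, 545259780), (8, 5, 603980064), (9, 0, 37749249), (9, 0, 75497985),
    (9, 1, 138412546), (9, 1, 276824578), (9, 4, 167772688), (9, 4, 335544848)],
   [(2, 10, 3146756), (3, 10, 3146760), (5, 10, 17826848), (6, 10, 17826880), (7, 10, 18875520),
    (8, 10, 18875648), (9, 10, 171968000), (9, 10, 343934464)],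
   [(1, 11, 5244930), (3, 11, 5244936), (4, 11, 34605072), (6, 11, 34605120), (7, 11, 37750912),
    (8, 11, 153094400), (8, 11, 612370688), (9, 11, 37751296), (10, 2, 2148533252), (10, 5,
    2148533280), (11, 1, 1074792450), (11, 4, 1074792464)],
   [(1, 12, 9441282), (2, 12, 9441284), (4, 12, 68161552), (5, 12, 68161568), (7, 12, 287314048),
    (7, 12, 574623872), (8, 12, 75501824), (9, 12, 75502080), (10, 3, 4296016904), (10, 6,
    4296016960), (10, 9, 6443501056), (11, 3, 4296017928), (11, 6, 4296017984), (11, 8,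
    5369760000), (12, 1, 1074794498), (12, 2, 2148536324), (12, 4, 1074794512), (12, 5,
    2148536352), (12, 7, 3222278272)],
   [(0, 13, 6299649), (0, 13, 3221233665), (1, 11, 9663678466), (2, 10, 10737419268), (3, 13,
    6299656), (4, 13, 136323088), (5, 13, 138420256), (6, 13, 51388480), (6, 13, 813703232), (8,
    13, 136323328), (9, 13, 138420736), (10, 2, 8592032772), (10, 7, 8592032896), (11, 1,
    8594130946), (11, 7, 8594131072), (12, 13, 3221237760), (13, 0, 1075847169), (13, 0,
    2151686145), (13, 4, 1075847184), (13, 5, 2151686176)],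
   [(0, 14, 10502145), (0, 14, 5368725505), (1, 12, 18253615106), (2, 14, 10502148), (3, 10,
    21474837512), (4, 14, 270549008), (5, 14, 84951072), (5, 14, 675299360), (6, 14, 276840512),
    (7, 14, 270549120), (9, 14, 276840960), (10, 3, 17181967368), (10, 8, 17181967616), (10, 9,
    25771902464), (11, 14, 5368727552), (12, 1, 17188261890), (12, 8, 17188262144), (13, 3,
    17181974536), (13, 6, 18255716416), (13, 8, 17181974784), (13, 12, 18253623296), (14, 0,
    1075855361), (14, 0, 4303372289), (14, 2, 8592048132), (14, 4, 1075855376), (14, 5,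
    9665789984), (14, 6, 4303372352), (14, 7, 8592048256), (14, 11, 9663694848)],
   [(0, 15, 12615681), (0, 15, 6442483713), (1, 15, 12615682), (1, 15, 25769836546), (2, 12,
    36507226116), (2, 14, 42949689348), (3, 11, 38654707720), (3, 13, 51539615752), (4, 15,
    101744656), (4, 15, 404783120), (5, 15, 541098016), (6, 15, 545292352), (7, 15, 541098112), (8,
    15, 545292544), (10, 15, 6442484736), (10, 15, 25769837568), (11, 3, 34363934728), (11, 8,
    42953869568), (11, 9, 34363935232), (11, 14, 42949691392), (12, 2, 34368131076), (12, 7,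
    51548000384), (12, 9, 34368131584), (12, 13, 51539619840), (13, 3, 34363940872), (13, 6,
    36511424576), (13, 9, 34363941376), (13, 12, 36507234304), (14, 2, 34368143364), (14, 5,
    38663110688), (14, 9, 34368143872), (14, 11, 38654724096), (15, 0, 2151710721), (15, 0,
    4303388673), (15, 1, 8594161666), (15, 1, 17188290562), (15, 4, 10741645328), (15, 4,
    21483257872), (15, 5, 2151710752), (15, 6, 4303388736), (15, 7, 8594161792), (15, 8,
    17188290816), (15, 10, 10737452032), (15, 10, 21474870272)],
   [(0, 16, 50397185), (0, 16, 3221291009), (1, 16, 151060482), (1, 16, 9663741954), (2, 16,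
    167837700), (2, 16, 10737483780), (3, 16, 7405576), (3, 16, 872480776), (3, 16, 55834640392),
    (4, 11, 69793220624), (4, 13, 69793226768), (5, 10, 70866961440), (5, 13, 70866968608), (6, 16,
    50397248), (7, 10, 77309412480), (7, 11, 77309413504), (8, 16, 151060736), (9, 16, 167838208),
    (10, 5, 68736255008), (10, 7, 68736255104), (11, 4, 68753033232), (11, 7, 68753033344), (12,
    16, 3221295104), (13, 4, 68853702672), (13, 5, 68853702688), (14, 16, 9663758336), (15, 16,
    10737516544), (16, 0, 1090584577), (16, 0, 2181103617), (16, 1, 1090584578), (16, 1,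
    8724217858), (16, 2, 2181103620), (16, 2, 8724217860)],
   [(0, 17, 84017153), (0, 17, 5368840193), (1, 17, 285343746), (1, 17, 18253742082), (2, 17,
    11665412), (2, 17, 704774148), (2, 17, 45097287684), (3, 17, 335675400), (3, 17, 21474967560),
    (4, 12, 138512699408), (4, 14, 138512711696), (4, 15, 207232204816), (5, 17, 84017184), (6, 10,
    141733921856), (6, 14, 141733937216), (7, 17, 285343872), (8, 10, 154618823936), (8, 12,
    154618827008), (9, 17, 335675904), (10, 6, 137455731776), (10, 8, 137455731968), (10, 9,
    206175208960), (11, 17, 5368842240), (12, 4, 137506066448), (12, 8, 137506066688), (13, 17,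
    18253750272), (14, 4, 137707405328), (14, 6, 137707405376), (15, 17, 21475000320), (16, 3,
    138529538056), (16, 6, 137455796288), (16, 8, 137455796480), (16, 12, 138512764928), (16, 14,
    138512777216), (17, 0, 1090650113), (17, 0, 4362207233), (17, 1, 1090650114), (17, 1,
    17448435714), (17, 2, 69810126852), (17, 3, 4362207240), (17, 3, 17448435720), (17, 5,
    68736385056), (17, 7, 68736385152), (17, 11, 69793351680), (17, 13, 69793357824)],
   [(0, 18, 100925441), (0, 18, 6442713089), (1, 18, 13893634), (1, 18, 419692546), (1, 18,
    26843807746), (2, 18, 570687492), (2, 18, 36507484164), (3, 18, 604241928), (3, 18,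
    38654967816), (4, 18, 100925456), (4, 18, 206158692368), (5, 12, 277025394720), (5, 14,
    345744883744), (5, 15, 277025423392), (5, 17, 343597514784), (6, 11, 279172876352), (6, 13,
    416611835968), (6, 15, 279172907072), (6, 16, 412316926016), (7, 18, 570687616), (8, 18,
    604242176), (9, 11, 309237647872), (9, 12, 309237649920), (10, 18, 6442714112), (10, 18,
    206158693376), (11, 6, 274911463488), (11, 8, 343630940416), (11, 9, 274911463936), (11, 17,
    343597516800), (12, 5, 274945019936), (12, 7, 412383973504), (12, 9, 274945020416), (12, 16,
    412316930048), (13, 18, 36507492352), (14, 18, 38654984192), (15, 5, 275414810656), (15, 6,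
    275414810688), (16, 3, 277059010568), (16, 6, 274911526976), (16, 9, 274911527424), (16, 12,
    277025460224), (16, 15, 277025488896), (17, 2, 279240114180), (17, 5, 274945146912), (17, 9,
    274945147392), (17, 11, 279173007360), (17, 15, 279173038080), (18, 0, 2181300225), (18, 0,
    4362338305), (18, 1, 70900776962), (18, 1, 141801291778), (18, 2, 2181300228), (18, 2,
    34896871428), (18, 3, 4362338312), (18, 3, 34896871432), (18, 4, 68753293328), (18, 4,
    137506324496), (18, 7, 68753293440), (18, 8, 137506324736), (18, 10, 70867223552), (18, 10,
    141734183936), (18, 13, 70867230720), (18, 14, 141734199296)],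
   [(0, 19, 15204353), (0, 19, 117964801), (0, 19, 7516717057), (1, 19, 403177474), (1, 19,
    25770328066), (2, 19, 671612932), (2, 19, 42950197252), (3, 19, 805830664), (3, 19,
    51540131848), (4, 19, 403177488), (4, 19, 206158954512), (5, 19, 671612960), (5, 19,
    343597908000), (6, 19, 805830720), (6, 19, 412317384768), (7, 12, 627065229440), (7, 14,
    558345764992), (7, 15, 558345781376), (7, 17, 618475421824), (7, 18, 618475552896), (8, 11,
    704374638848), (8, 13, 566935691520), (8, 15, 566935716096), (8, 16, 687194833152), (8, 18,
    687195029760), (9, 10, 858993460736), (9, 13, 584115560960), (9, 14, 584115569152), (9, 16,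
    824633786880), (9, 17, 824633852416), (10, 19, 25770329088), (10, 19, 206158955520), (11, 19,
    42950199296), (11, 19, 343597910016), (12, 19, 51540135936), (12, 19, 412317388800), (13, 6,
    618609516608), (13, 8, 549890040064), (13, 9, 549890040320), (13, 17, 618475429888), (13, 18,
    618475560960), (14, 5, 687463219232), (14, 7, 550024265856), (14, 9, 550024266240), (14, 16,
    687194849280), (14, 18, 687195045888), (15, 4, 825170624528), (15, 7, 550292717696), (15, 8,
    550292717824), (15, 16, 824633819136), (15, 17, 824633884672), (16, 3, 558480031752), (16, 8,
    549890097408), (16, 9, 549890097664), (16, 14, 558345830400), (16, 15, 558345846784), (17, 2,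
    567204249604), (17, 7, 550024380544), (17, 9, 550024380928), (17, 13, 566935822336), (17, 15,
    566935846912), (18, 1, 584652685314), (18, 7, 550292947072), (18, 8, 550292947200), (18, 13,
    584115822592), (18, 14, 584115830784), (19, 0, 77444153345), (19, 0, 154887782401), (19, 0,
    309775040513), (19, 1, 8724676610), (19, 1, 17448828930), (19, 2, 8724676612), (19, 2,
    34897133572), (19, 3, 17448828936), (19, 3, 34897133576), (19, 4, 68854218768), (19, 4,
    137707913232), (19, 5, 68854218784), (19, 5, 275415302176), (19, 6, 137707913280), (19, 6,
    275415302208), (19, 10, 77309936640), (19, 10, 154619347968), (19, 11, 77309937664), (19, 11,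
    309238171648), (19, 12, 154619351040), (19, 12, 309238173696)]]

/-- Some clause in `l` is violated by the partial assignment `s`, where bit `k` of `s` says that
triple `k` is a basis and bit `20 + k` says that it is not. -/
noncomputable def viol (s : ℕ) (l : List (ℕ × ℕ × ℕ)) : Bool :=
  List.rec false (fun c _ ih => cond (Nat.beq (Nat.land s c.2.2) c.2.2) true ih) l

/-- Backtracking search: `true` means that no completion has exactly eleven bases. -/
noncomputable def search (ls : List (List (ℕ × ℕ × ℕ))) : ℕ → ℕ → ℕ → Bool :=
  List.rec (fun _ _ c => cond (Nat.beq c 11) false true)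
    (fun l _ ih k s c =>
      cond (Nat.ble 12 c) true <| cond (Nat.ble (Nat.add c 10) k) true <|
      cond (cond (viol (Nat.lor s (Nat.pow 2 (Nat.add 20 k))) l) true
          (ih (Nat.succ k) (Nat.lor s (Nat.pow 2 (Nat.add 20 k))) c))
        (cond (viol (Nat.lor s (Nat.pow 2 k)) l) true
          (ih (Nat.succ k) (Nat.lor s (Nat.pow 2 k)) (Nat.succ c))) false) ls

theorem search_levels : search levels 0 0 0 = true := by decide +kernel

/-- A clause is a genuine instance of basis exchange. -/
def Valid (c : ℕ × ℕ × ℕ) : Prop :=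
  c.1 < 20 ∧ c.2.2.testBit c.1 = true ∧ c.2.1 < 20 ∧ c.2.2.testBit c.2.1 = true ∧
    ∃ x ∈ T c.1, x ∉ T c.2.1 ∧ ∀ y ∈ T c.2.1, y ∈ T c.1 ∨
      ∃ k < 20, c.2.2.testBit (20 + k) = true ∧ insert y ((T c.1).erase x) = T k

instance (c : ℕ × ℕ × ℕ) : Decidable (Valid c) := by unfold Valid; infer_instance

theorem levels_valid : ∀ l ∈ levels, ∀ c ∈ l, Valid c := by decide +kernel

theorem viol_cons (s : ℕ) (c : ℕ × ℕ × ℕ) (l : List (ℕ × ℕ × ℕ)) :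
    viol s (c :: l) = cond (Nat.beq (s &&& c.2.2) c.2.2) true (viol s l) := rfl

theorem search_cons (l : List (ℕ × ℕ × ℕ)) (ls : List (List (ℕ × ℕ × ℕ))) (k s c : ℕ) :
    search (l :: ls) k s c = cond (Nat.ble 12 c) true (cond (Nat.ble (c + 10) k) true
      (cond (cond (viol (s ||| 2 ^ (20 + k)) l) true (search ls (k + 1) (s ||| 2 ^ (20 + k)) c))
        (cond (viol (s ||| 2 ^ k) l) true (search ls (k + 1) (s ||| 2 ^ k) (c + 1))) false)) := rfl

theorem testBit_or_two_pow {m k i : ℕ} (h : (m ||| 2 ^ k).testBit i = true) :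
    m.testBit i = true ∨ i = k := by
  rw [Nat.testBit_or, Bool.or_eq_true] at h
  rcases h with h | h
  · exact Or.inl h
  · right
    rw [Nat.testBit_two_pow] at h
    simpa [eq_comm] using h

/-- The partial assignment `s` agrees with `b`. -/
def Agrees (b : ℕ → Bool) (s : ℕ) : Prop :=
  ∀ i < 20, (s.testBit i = true → b i = true) ∧ (s.testBit (20 + i) = true → b i = false)

/-- What a clause says about an assignment. -/
def Holds (b : ℕ → Bool) (c : ℕ × ℕ × ℕ) : Prop :=
  c.1 < 20 ∧ c.2.2.testBit c.1 = true ∧ c.2.1 < 20 ∧ c.2.2.testBit c.2.1 = true ∧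
    (b c.1 = true → b c.2.1 = true → ∃ k < 20, c.2.2.testBit (20 + k) = true ∧ b k = true)

theorem viol_false (b : ℕ → Bool) (s : ℕ) (hs : Agrees b s) (l : List (ℕ × ℕ × ℕ))
    (hl : ∀ c ∈ l, Holds b c) : viol s l = false := by
  induction l with
  | nil => rfl
  | cons c l ih =>
    rw [viol_cons, ih (fun c' hc' => hl c' (by simp [hc']))]
    cases hq : Nat.beq (s &&& c.2.2) c.2.2 with
    | false => rfl
    | true =>
      exfalso
      have hq := Nat.eq_of_beq_eq_true hq
      have sub : ∀ i, c.2.2.testBit i = true → s.testBit i = true := by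
        intro i hi
        rw [← hq, Nat.testBit_and, Bool.and_eq_true] at hi
        exact hi.1
      obtain ⟨ha, hat, hb, hbt, hex⟩ := hl c (by simp)
      obtain ⟨k, hk, hkt, hbk⟩ := hex ((hs _ ha).1 (sub _ hat)) ((hs _ hb).1 (sub _ hbt))
      have := (hs k hk).2 (sub _ hkt)
      simp [this] at hbk

/-- Soundness of the search. -/
theorem search_sound (b : ℕ → Bool) (ls : List (List (ℕ × ℕ × ℕ)))
    (hb : ∀ l ∈ ls, ∀ c ∈ l, Holds b c) :
    ∀ k s c : ℕ, k + ls.length = 20 → Agrees b s → search ls k s c = true →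
      c + (List.range' k ls.length).countP b ≠ 11 := by
  induction ls with
  | nil =>
    intro k s c _ _ hs
    simp only [List.length_nil, List.range'_zero, List.countP_nil, Nat.add_zero]
    rintro rfl
    exact Bool.noConfusion hs
  | cons l ls ih =>
    intro k s c hk hm hs
    have hle := List.countP_le_length (p := b) (l := List.range' k (l :: ls).length)
    rw [List.length_range'] at hle
    have nobad := fun s' hs' => viol_false b s' hs' l (hb l (by simp))
    have ih' := ih (fun l' hl' => hb l' (by simp [hl']))
    rw [search_cons] at hs
    cases hc1 : Nat.ble 12 c with
    | true => have := Nat.le_of_ble_eq_true hc1; omega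
    | false =>
    cases hc2 : Nat.ble (c + 10) k with
    | true => have := Nat.le_of_ble_eq_true hc2; omega
    | false =>
    rw [hc1, hc2, cond_false, cond_false] at hs
    obtain ⟨h0, h1⟩ : cond (viol (s ||| 2 ^ (20 + k)) l) true
          (search ls (k + 1) (s ||| 2 ^ (20 + k)) c) = true ∧
        cond (viol (s ||| 2 ^ k) l) true (search ls (k + 1) (s ||| 2 ^ k) (c + 1)) = true := by
      revert hs
      generalize cond (viol (s ||| 2 ^ (20 + k)) l) true _ = p
      generalize cond (viol (s ||| 2 ^ k) l) true _ = q
      cases p <;> cases q <;> simp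
    rw [List.length_cons] at hk
    rw [List.length_cons, List.range'_succ, List.countP_cons]
    cases hbk : b k with
    | false =>
      have hm' : Agrees b (s ||| 2 ^ (20 + k)) := by
        intro i hi
        constructor <;> intro hit <;> rcases testBit_or_two_pow hit with h | h
        · exact (hm i hi).1 h
        · omega
        · exact (hm i hi).2 h
        · obtain rfl : i = k := by omega
          exact hbk
      rw [nobad _ hm', cond_false] at h0
      have := ih' (k + 1) _ c (by omega) hm' h0
      simpa using this
    | true =>
      have hm' : Agrees b (s ||| 2 ^ k) := by
        intro i hi
        constructor <;> intro hit <;> rcases testBit_or_two_pow hit with h | h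
        · exact (hm i hi).1 h
        · exact h ▸ hbk
        · exact (hm i hi).2 h
        · omega
      rw [nobad _ hm', cond_false] at h1
      have := ih' (k + 1) _ (c + 1) (by omega) hm' h1
      simp only [if_true]
      omega

/-- Basis exchange from the rank axioms. -/
theorem exchange {β : Type*} [DecidableEq β] (r : Finset β → ℤ)
    (h : (∀ A : Finset β, 0 ≤ r A ∧ r A ≤ (A.card : ℤ)) ∧
      (∀ A B : Finset β, A ⊆ B → r A ≤ r B) ∧
      (∀ A B : Finset β, r (A ∩ B) + r (A ∪ B) ≤ r A + r B))
    (A B : Finset β) (hcA : A.card = 3) (hA : r A = 3) (hB : r B = 3) (x : β) (hx : x ∈ A)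
    (hxB : x ∉ B) (hall : ∀ y ∈ B, y ∉ A → r (insert y (A.erase x)) ≤ 2) : False := by
  obtain ⟨h1, h2, h3⟩ := h
  have hAx : 2 ≤ r (A.erase x) := by
    have e1 := h3 (A.erase x) {x}
    have e2 : A.erase x ∪ {x} = A := by
      rw [Finset.union_comm, ← Finset.insert_eq, Finset.insert_erase hx]
    rw [e2, hA] at e1
    have e3 := (h1 {x}).2
    have e4 := (h1 (A.erase x ∩ {x})).1
    simp only [Finset.card_singleton, Nat.cast_one] at e3
    omega
  have hAx3 : r (A.erase x) ≤ 2 := by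
    have e1 := (h1 (A.erase x)).2
    rw [Finset.card_erase_of_mem hx, hcA] at e1
    exact e1
  · have key : ∀ S : Finset β, S ⊆ B → r (A.erase x ∪ S) ≤ 2 := by
      intro S
      induction S using Finset.induction_on with
      | empty => intro _; simpa using hAx3
      | insert y S hy ih =>
        intro hS
        have hyB : y ∈ B := hS (Finset.mem_insert_self _ _)
        have ihS := ih (fun z hz => hS (Finset.mem_insert_of_mem hz))
        have hy2 : r (insert y (A.erase x)) ≤ 2 := by
          by_cases hyA : y ∈ A
          · rw [Finset.insert_eq_of_mem]
            · exact hAx3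
            · exact Finset.mem_erase.2 ⟨fun e => hxB (e ▸ hyB), hyA⟩
          · exact hall y hyB hyA
        have e1 := h3 (A.erase x ∪ S) (insert y (A.erase x))
        have e2 := h2 (A.erase x) ((A.erase x ∪ S) ∩ insert y (A.erase x))
          (Finset.subset_inter Finset.subset_union_left (Finset.subset_insert _ _))
        have e3 := h2 (A.erase x ∪ insert y S) ((A.erase x ∪ S) ∪ insert y (A.erase x)) (by
          intro z hz
          simp only [Finset.mem_union, Finset.mem_insert] at hz ⊢
          tauto)
        omega
    have := key B subset_rfl
    have := h2 B _ (Finset.subset_union_right (s₁ := A.erase x))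
    omega

theorem T_inj : ∀ i < 20, ∀ j < 20, T i = T j → i = j := by decide +kernel

theorem T_image : (Finset.range 20).image T = Finset.powersetCard 3 Finset.univ := by
  decide +kernel

theorem T_card : ∀ i < 20, (T i).card = 3 := by decide +kernel

theorem fin_case (r : Finset (Fin 6) → ℤ)
    (h : (∀ A : Finset (Fin 6), 0 ≤ r A ∧ r A ≤ (A.card : ℤ)) ∧
      (∀ A B : Finset (Fin 6), A ⊆ B → r A ≤ r B) ∧
      (∀ A B : Finset (Fin 6), r (A ∩ B) + r (A ∪ B) ≤ r A + r B))
    (hr : r Finset.univ = 3) :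
    {B : Finset (Fin 6) | (B.card : ℤ) = r B ∧ r B = 3}.ncard ≠ 11 := by
  have hle3 : ∀ A, r A ≤ 3 := fun A => hr ▸ h.2.1 A _ (Finset.subset_univ A)
  have hs := search_sound (fun k => decide (r (T k) = 3)) levels (by
    intro l hl c hc
    obtain ⟨hc1, ht1, hc2, ht2, x, hx, hxB, hv⟩ := levels_valid l hl c hc
    refine ⟨hc1, ht1, hc2, ht2, fun ha hb => ?_⟩
    by_contra hno
    push Not at hno
    refine exchange r h _ _ (T_card _ hc1) (of_decide_eq_true ha) (of_decide_eq_true hb) x hx hxB ?_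
    intro y hy hyA
    rcases hv y hy with hy' | ⟨k, hk, hkt, hke⟩
    · exact absurd hy' hyA
    · rw [hke]
      have h1 := hno k hk hkt
      have h2 := hle3 (T k)
      simp only [ne_eq, decide_eq_true_eq] at h1
      omega) 0 0 0 rfl (by intro i _; simp) search_levels
  have hset : {B : Finset (Fin 6) | (B.card : ℤ) = r B ∧ r B = 3} =
      (((Finset.range 20).filter (fun k => r (T k) = 3)).image T : Finset (Finset (Fin 6))) := by
    ext B
    simp only [Set.mem_ofPred_eq, Finset.coe_image, Set.mem_image, Finset.coe_filter]
    constructor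
    · rintro ⟨h1, h2⟩
      have hB : B ∈ Finset.powersetCard 3 (Finset.univ : Finset (Fin 6)) := by
        rw [Finset.mem_powersetCard]
        exact ⟨Finset.subset_univ _, by omega⟩
      rw [← T_image, Finset.mem_image] at hB
      obtain ⟨k, hk, rfl⟩ := hB
      exact ⟨k, ⟨hk, h2⟩, rfl⟩
    · rintro ⟨k, ⟨hk, h2⟩, rfl⟩
      have hB := Finset.mem_image_of_mem T hk
      rw [T_image, Finset.mem_powersetCard] at hB
      exact ⟨by rw [hB.2, h2]; rfl, h2⟩
  rw [hset, Set.ncard_coe_finset, Finset.card_image_of_injOn]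
  · have hl : levels.length = 20 := rfl
    rw [hl, zero_add, ← List.range_eq_range', List.countP_eq_length_filter] at hs
    exact hs
  · intro i hi j hj hij
    simp only [Finset.coe_filter, Finset.mem_range, Set.mem_ofPred_eq] at hi hj
    exact T_inj i hi.1 j hj.1 hij

end ElevenBases

theorem no_rank3_six_elements_eleven_bases (r : Finset α → ℤ)
    (h : RankAxioms r) (hcard : Fintype.card α = 6) (hrank : r Finset.univ = 3) :
    {B : Finset α | (B.card : ℤ) = r B ∧ r B = r Finset.univ}.ncard ≠ 11 := by
  obtain ⟨e⟩ : Nonempty (α ≃ Fin 6) := ⟨Fintype.equivFinOfCardEq hcard⟩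
  obtain ⟨h1, h2, h3⟩ := h
  have key := ElevenBases.fin_case (fun S => r (S.map e.symm.toEmbedding))
    ⟨fun A => by simpa using h1 (A.map e.symm.toEmbedding),
      fun A B hAB => h2 _ _ (Finset.map_subset_map.2 hAB),
      fun A B => by
        simpa only [Finset.map_inter, Finset.map_union] using
          h3 (A.map e.symm.toEmbedding) (B.map e.symm.toEmbedding)⟩
    (by simpa using hrank)
  rw [hrank]
  convert key using 1
  rw [← Set.ncard_image_of_injective _ (Finset.map_injective e.symm.toEmbedding)]
  congr 1
  ext B
  simp only [Set.mem_ofPred_eq, Set.mem_image]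
  constructor
  · rintro ⟨hB1, hB2⟩
    have hB : (B.map e.toEmbedding).map e.symm.toEmbedding = B := by
      ext a
      simp
    exact ⟨B.map e.toEmbedding, by rw [hB, Finset.card_map]; exact ⟨hB1, hB2⟩, hB⟩
  · rintro ⟨S, ⟨hS1, hS2⟩, rfl⟩
    exact ⟨by rw [Finset.card_map]; exact hS1, hS2⟩
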